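/- Let k ≥ 1 and let L be a finite relational language all of whose relation symbols have arity k. Let μ be a non-redundant invariant measure on Str_L(ℕ). Then there is a constant C ≥ 0 such that Ent(μ)(n) = C·n^k + o(n^k); in particular Ent(μ)(n) = O(n^k). -/

import Mathlib

open FirstOrder MeasureTheory
open scoped ENNReal

namespace PaperEntropy

/-- The logic action of a permutation of `ℕ` on the space of `L`-structures with
underlying set `ℕ`. -/
noncomputable def logicAction (L : FirstOrder.Language) (σ : Equiv.Perm ℕ)
    (S : L.Structure ℕ) : L.Structure ℕ where
  funMap := fun {m} f v => σ (@FirstOrder.Language.Structure.funMap L ℕ S m f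
    (fun i => σ.symm (v i)))
  RelMap := fun {m} r v => @FirstOrder.Language.Structure.RelMap L ℕ S m r
    (fun i => σ.symm (v i))

/-- Generating sets for the σ-algebra on the space of `L`-structures on `M`:
satisfaction sets of quantifier-free formulas at tuples of parameters. -/
def qfSets (L : FirstOrder.Language) (M : Type*) : Set (Set (L.Structure M)) :=
  { A | ∃ (m : ℕ) (φ : L.Formula (Fin m)), φ.IsQF ∧ ∃ v : Fin m → M,
      A = { S : L.Structure M | @FirstOrder.Language.Formula.Realize L M S (Fin m) φ v } }

noncomputable instance strMeasurableSpace (L : FirstOrder.Language) (M : Type*) :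
    MeasurableSpace (L.Structure M) :=
  MeasurableSpace.generateFrom (qfSets L M)

/-- `μ` is an invariant (probability) measure on `Str_L(ℕ)`. -/
def IsInvariantMeasure (L : FirstOrder.Language) (μ : Measure (L.Structure ℕ)) : Prop :=
  IsProbabilityMeasure μ ∧ ∀ σ : Equiv.Perm ℕ, Measure.map (logicAction L σ) μ = μ

/-- The set of non-redundant `L`-structures on `M`: relations hold only of tuples of
pairwise distinct elements. -/
def NonRedundant (L : FirstOrder.Language) (M : Type*) : Set (L.Structure M) :=
  { S | ∀ (m : ℕ) (r : L.Relations m) (v : Fin m → M),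
      @FirstOrder.Language.Structure.RelMap L M S m r v → Function.Injective v }

/-- The data of the restriction of an `L`-structure on `ℕ` to `[n] = {0, …, n-1}`:
the relational part, and the functional part recorded as `none` on tuples whose image
under the function escapes `[n]`. -/
structure FinRestriction (L : FirstOrder.Language) (n : ℕ) where
  rel : ∀ m, L.Relations m → (Fin m → Fin n) → Prop
  fn : ∀ m, L.Functions m → (Fin m → Fin n) → Option (Fin n)

instance finRestrictionMeasurableSpace (L : FirstOrder.Language) (n : ℕ) :
    MeasurableSpace (FinRestriction L n) :=
  MeasurableSpace.generateFrom
    ({ A | ∃ m r v, A = {x : FinRestriction L n | x.rel m r v} } ∪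
     { A | ∃ m f v o, A = {x : FinRestriction L n | x.fn m f v = o} })

/-- The restriction of an `L`-structure on `ℕ` to `[n]`. -/
noncomputable def restrict (L : FirstOrder.Language) (n : ℕ) (S : L.Structure ℕ) :
    FinRestriction L n where
  rel m r v := @FirstOrder.Language.Structure.RelMap L ℕ S m r (fun i => (v i : ℕ))
  fn m f v :=
    if h : (@FirstOrder.Language.Structure.funMap L ℕ S m f (fun i => (v i : ℕ))) < n
    then some ⟨_, h⟩ else none

/-- The entropy of a measure: `∞` if it is not purely atomic, and otherwise
`-∑ ν {x} log₂ ν {x}` over its atoms. -/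
noncomputable def entropy {α : Type*} [MeasurableSpace α] (ν : Measure α) : ℝ≥0∞ :=
  if ∑' a : α, ν {a} = ν Set.univ then
    ∑' a : α, ENNReal.ofReal (-((ν {a}).toReal * Real.logb 2 (ν {a}).toReal))
  else ⊤

/-- The entropy function of a measure on `Str_L(ℕ)`: the entropy of the measure induced
by restriction to `[n]`. -/
noncomputable def entFn (L : FirstOrder.Language) (μ : Measure (L.Structure ℕ)) (n : ℕ) :
    ℝ≥0∞ :=
  entropy (Measure.map (restrict L n) μ)

end PaperEntropy

namespace PaperEntropy
section FiniteEntropy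
open Finset
open scoped Classical

variable {Ω : Type*} [Fintype Ω]

/-- The total weight of the class of `ω` modulo `r`. -/
noncomputable def classMass (p : Ω → ℝ) (r : Setoid Ω) (ω : Ω) : ℝ :=
  ∑ ω', if r ω' ω then p ω' else 0

/-- The entropy (in nats) of the partition into classes of `r`, for the weights `p`. -/
noncomputable def partitionEntropy (p : Ω → ℝ) (r : Setoid Ω) : ℝ :=
  -∑ ω, p ω * Real.log (classMass p r ω)

lemma classMass_congr (p : Ω → ℝ) {r : Setoid Ω} {a b : Ω} (h : r a b) :
    classMass p r a = classMass p r b := by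
  unfold classMass
  refine sum_congr rfl fun c _ => ?_
  have : r c a ↔ r c b := ⟨fun hc => r.trans hc h, fun hc => r.trans hc (r.symm h)⟩
  simp only [this]

lemma classMass_nonneg {p : Ω → ℝ} (hp : ∀ ω, 0 ≤ p ω) (r : Setoid Ω) (ω : Ω) :
    0 ≤ classMass p r ω :=
  sum_nonneg fun c _ => by split_ifs <;> simp [hp]

lemma classMass_mono {p : Ω → ℝ} (hp : ∀ ω, 0 ≤ p ω) {r s : Setoid Ω} (h : r ≤ s) (ω : Ω) :
    classMass p r ω ≤ classMass p s ω := by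
  refine sum_le_sum fun c _ => ?_
  by_cases hc : r c ω
  · simp [hc, show s c ω from h hc]
  · rw [if_neg hc]
    split_ifs <;> simp [hp]

lemma le_classMass {p : Ω → ℝ} (hp : ∀ ω, 0 ≤ p ω) (r : Setoid Ω) (ω : Ω) :
    p ω ≤ classMass p r ω := by
  have := single_le_sum (f := fun ω' => if r ω' ω then p ω' else 0) (s := univ)
    (fun c _ => by split_ifs <;> simp [hp]) (mem_univ ω)
  simpa [classMass, r.refl ω] using this

lemma partitionEntropy_mono {p : Ω → ℝ} (hp : ∀ ω, 0 ≤ p ω) {r s : Setoid Ω} (h : r ≤ s) :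
    partitionEntropy p s ≤ partitionEntropy p r := by
  refine neg_le_neg (sum_le_sum fun ω _ => ?_)
  rcases (hp ω).eq_or_lt with h0 | h0
  · simp [← h0]
  · exact mul_le_mul_of_nonneg_left (Real.log_le_log (h0.trans_le (le_classMass hp r ω))
      (classMass_mono hp h ω)) h0.le

lemma partitionEntropy_top {p : Ω → ℝ} (h1 : ∑ ω, p ω = 1) :
    partitionEntropy p ⊤ = 0 := by
  simp [partitionEntropy, classMass, h1]

lemma sum_div_classMass_inf_le_one (p : Ω → ℝ) (r s : Setoid Ω) (a b : Ω) :
    ∑ ω, (if r a ω ∧ s b ω then p ω / classMass p (r ⊓ s) ω else 0) ≤ 1 := by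
  by_cases h : ∃ c, r a c ∧ s b c
  · obtain ⟨c, hac, hbc⟩ := h
    have key : ∀ ω, (if r a ω ∧ s b ω then p ω / classMass p (r ⊓ s) ω else 0) =
        (if (r ⊓ s) ω c then p ω else 0) / classMass p (r ⊓ s) c := by
      intro ω
      have hiff : (r a ω ∧ s b ω) ↔ (r ⊓ s) ω c :=
        ⟨fun h => ⟨r.trans (r.symm h.1) hac, s.trans (s.symm h.2) hbc⟩,
          fun h => ⟨r.trans hac (r.symm h.1), s.trans hbc (s.symm h.2)⟩⟩
      by_cases hω : (r ⊓ s) ω c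
      · rw [if_pos (hiff.2 hω), if_pos hω, classMass_congr p hω]
      · rw [if_neg (mt hiff.1 hω), if_neg hω, zero_div]
    rw [sum_congr rfl fun ω _ => key ω, ← sum_div]
    exact div_self_le_one _
  · push Not at h
    rw [sum_eq_zero fun ω _ => if_neg fun hω => h ω hω.1 hω.2]
    exact zero_le_one

lemma sum_classMass_ratio_le_one {p : Ω → ℝ} (hp : ∀ ω, 0 ≤ p ω) (h1 : ∑ ω, p ω = 1)
    {r s t : Setoid Ω} (hrt : r ≤ t) (hst : s ≤ t) :
    ∑ ω, p ω * (classMass p r ω * classMass p s ω /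
      (classMass p (r ⊓ s) ω * classMass p t ω)) ≤ 1 := by
  calc _ = ∑ ω, ∑ a, ∑ b, p a * ((if t b a then p b else 0) / classMass p t a *
        (if r a ω ∧ s b ω then p ω / classMass p (r ⊓ s) ω else 0)) := by
        refine sum_congr rfl fun ω _ => ?_
        rw [show p ω * (classMass p r ω * classMass p s ω /
          (classMass p (r ⊓ s) ω * classMass p t ω)) = classMass p r ω * classMass p s ω *
          (p ω / classMass p (r ⊓ s) ω / classMass p t ω) by
            rw [div_div, mul_div_assoc', mul_div_assoc']; ring]
        conv_lhs => rw [classMass, classMass, sum_mul_sum, sum_mul]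
        refine sum_congr rfl fun a _ => ?_
        rw [sum_mul]
        refine sum_congr rfl fun b _ => ?_
        by_cases ha : r a ω
        · by_cases hb : s b ω
          · have hab : t b a := t.trans (hst hb) (t.symm (hrt ha))
            rw [if_pos ha, if_pos hb, if_pos hab, if_pos ⟨ha, hb⟩, classMass_congr p (hrt ha)]
            ring
          · simp [hb]
        · simp [ha]
    _ = ∑ a, p a * ∑ b, (if t b a then p b else 0) / classMass p t a *
        ∑ ω, (if r a ω ∧ s b ω then p ω / classMass p (r ⊓ s) ω else 0) := by
        rw [sum_comm]
        refine sum_congr rfl fun a _ => ?_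
        rw [sum_comm, mul_sum]
        refine sum_congr rfl fun b _ => ?_
        rw [mul_sum, mul_sum]
    _ ≤ ∑ a, p a * ∑ b, (if t b a then p b else 0) / classMass p t a := by
        refine sum_le_sum fun a _ => mul_le_mul_of_nonneg_left (sum_le_sum fun b _ => ?_) (hp a)
        refine mul_le_of_le_one_right (div_nonneg ?_ (classMass_nonneg hp t a))
          (sum_div_classMass_inf_le_one p r s a b)
        split_ifs <;> simp [hp]
    _ ≤ ∑ a, p a := by
        refine sum_le_sum fun a _ => mul_le_of_le_one_right (hp a) ?_
        rw [← sum_div]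
        exact div_self_le_one _
    _ = 1 := h1

lemma partitionEntropy_submodular {p : Ω → ℝ} (hp : ∀ ω, 0 ≤ p ω) (h1 : ∑ ω, p ω = 1)
    {r s t : Setoid Ω} (hrt : r ≤ t) (hst : s ≤ t) :
    partitionEntropy p (r ⊓ s) + partitionEntropy p t ≤
      partitionEntropy p r + partitionEntropy p s := by
  have key : ∀ ω, p ω * Real.log (classMass p r ω) + p ω * Real.log (classMass p s ω) -
      p ω * Real.log (classMass p (r ⊓ s) ω) - p ω * Real.log (classMass p t ω) ≤
      p ω * (classMass p r ω * classMass p s ω /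
        (classMass p (r ⊓ s) ω * classMass p t ω)) - p ω := by
    intro ω
    rcases (hp ω).eq_or_lt with h0 | h0
    · simp [← h0]
    · have pos : ∀ u : Setoid Ω, 0 < classMass p u ω := fun u => h0.trans_le (le_classMass hp u ω)
      have hlog := Real.log_le_sub_one_of_pos (x := classMass p r ω * classMass p s ω /
        (classMass p (r ⊓ s) ω * classMass p t ω))
        (div_pos (mul_pos (pos _) (pos _)) (mul_pos (pos _) (pos _)))
      rw [Real.log_div (mul_pos (pos _) (pos _)).ne' (mul_pos (pos _) (pos _)).ne',
        Real.log_mul (pos _).ne' (pos _).ne', Real.log_mul (pos _).ne' (pos _).ne'] at hlog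
      linarith [mul_le_mul_of_nonneg_left hlog h0.le]
  have hsum := sum_le_sum fun ω (_ : ω ∈ (univ : Finset Ω)) => key ω
  simp only [sum_sub_distrib, sum_add_distrib] at hsum
  have := sum_classMass_ratio_le_one hp h1 hrt hst
  unfold partitionEntropy
  linarith

lemma partitionEntropy_ker {Ω' : Type*} [Fintype Ω'] {p : Ω → ℝ} {q : Ω' → ℝ} {f : Ω → Ω'}
    (hq : ∀ y, q y = ∑ ω, if f ω = y then p ω else 0) :
    partitionEntropy p (Setoid.ker f) = ∑ y, Real.negMulLog (q y) := by
  have hm : ∀ ω, classMass p (Setoid.ker f) ω = q (f ω) := fun ω => (hq _).symm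
  simp only [partitionEntropy, hm]
  rw [← sum_fiberwise univ f, ← sum_neg_distrib]
  refine sum_congr rfl fun y _ => ?_
  rw [Real.negMulLog, hq y, ← sum_filter, neg_mul, sum_mul, ← sum_neg_distrib, ← sum_neg_distrib]
  refine sum_congr rfl fun ω hω => ?_
  rw [(mem_filter.1 hω).2, hq y, ← sum_filter]

variable {ι : Type*}

/-- Subsets of `ι` are equivalent when they agree on `A`. -/
def agreeOn (A : Set ι) : Setoid (Set ι) := Setoid.ker (fun x => x ∩ A)

lemma agreeOn_apply {A x y : Set ι} : agreeOn A x y ↔ ∀ e ∈ A, e ∈ x ↔ e ∈ y := by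
  change x ∩ A = y ∩ A ↔ _
  simp only [Set.ext_iff, Set.mem_inter_iff]
  exact forall_congr' fun e => by tauto

lemma agreeOn_anti {A B : Set ι} (h : A ⊆ B) : agreeOn B ≤ agreeOn A :=
  fun _ _ hxy => agreeOn_apply.2 fun e he => agreeOn_apply.1 hxy e (h he)

lemma agreeOn_union (A B : Set ι) : agreeOn (A ∪ B) = agreeOn A ⊓ agreeOn B := by
  ext x y
  change agreeOn (A ∪ B) x y ↔ agreeOn A x y ∧ agreeOn B x y
  simp only [agreeOn_apply, Set.mem_union, or_imp, forall_and]

/-- **Shearer's lemma** for a random subset of `ι`. -/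
lemma shearer [Fintype ι] {p : Set ι → ℝ} (hp : ∀ x, 0 ≤ p x) (h1 : ∑ x, p x = 1)
    {I : Type*} [Fintype I] (A : I → Set ι) (t : ℕ) (ht : ∀ e, t ≤ #{i | e ∈ A i}) :
    t * partitionEntropy p (agreeOn Set.univ) ≤ ∑ i, partitionEntropy p (agreeOn (A i)) := by
  have main : ∀ S : Finset ι, t * partitionEntropy p (agreeOn (S : Set ι)) ≤
      ∑ i, partitionEntropy p (agreeOn (A i ∩ S)) := by
    intro S
    induction S using Finset.induction_on with
    | empty =>
      have : agreeOn (∅ : Set ι) = ⊤ := by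
        ext x y
        simp [agreeOn_apply, Setoid.top_def]
      simp [this, partitionEntropy_top h1]
    | insert e S he ih =>
      set d := partitionEntropy p (agreeOn (insert e S : Set ι)) -
        partitionEntropy p (agreeOn (S : Set ι)) with hd
      have hd0 : 0 ≤ d :=
        sub_nonneg.2 (partitionEntropy_mono hp (agreeOn_anti (Set.subset_insert _ _)))
      have step : ∀ i, (if e ∈ A i then d else 0) ≤
          partitionEntropy p (agreeOn (A i ∩ insert e S)) -
            partitionEntropy p (agreeOn (A i ∩ S)) := by
        intro i
        split_ifs with hi
        · have hunion : (A i ∩ insert e S) ∪ (S : Set ι) = insert e (S : Set ι) := by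
            ext x
            simp only [Set.mem_union, Set.mem_inter_iff, Set.mem_insert_iff]
            constructor
            · tauto
            · rintro (rfl | h) <;> tauto
          have := partitionEntropy_submodular hp h1 (r := agreeOn (A i ∩ insert e S))
            (s := agreeOn (S : Set ι)) (t := agreeOn (A i ∩ S))
            (agreeOn_anti (Set.inter_subset_inter_right _ (Set.subset_insert _ _)))
            (agreeOn_anti Set.inter_subset_right)
          rw [← agreeOn_union, hunion] at this
          linarith
        · exact sub_nonneg.2 (partitionEntropy_mono hp (agreeOn_anti
            (Set.inter_subset_inter_right _ (Set.subset_insert _ _))))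
      have hsum := sum_le_sum fun i (_ : i ∈ (univ : Finset I)) => step i
      rw [← sum_filter, sum_const, nsmul_eq_mul, sum_sub_distrib] at hsum
      have hcard : (t : ℝ) * d ≤ (#{i | e ∈ A i} : ℝ) * d :=
        mul_le_mul_of_nonneg_right (by exact_mod_cast ht e) hd0
      rw [coe_insert]
      rw [hd] at hsum hcard
      linarith
  simpa using main univ

end FiniteEntropy

section Limit
open Filter Topology Asymptotics

lemma exists_tendsto_div_pow {g : ℕ → ℝ} (h0 : ∀ n, 0 ≤ g n) (k : ℕ)
    (hg : ∀ n, k ≤ n → ((n + 1 - k : ℕ) : ℝ) * g (n + 1) ≤ (n + 1 : ℕ) * g n) :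
    ∃ C : ℝ, 0 ≤ C ∧ Tendsto (fun n : ℕ => g n / (n : ℝ) ^ k) atTop (𝓝 C) := by
  set a : ℕ → ℝ := fun n => g (n + k) / ((n + k).choose k : ℝ) with ha
  have ha0 : ∀ n, 0 ≤ a n := fun n => div_nonneg (h0 _) (Nat.cast_nonneg _)
  have hanti : Antitone a := by
    refine antitone_nat_of_succ_le fun n => ?_
    have hpos : ∀ m, (0 : ℝ) < ((m + k).choose k : ℝ) := fun m => by
      exact_mod_cast Nat.choose_pos (Nat.le_add_left k m)
    have hstep := hg (n + k) (Nat.le_add_left k n)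
    have hch := Nat.choose_mul_succ_eq (n + k) k
    have e1 : n + k + 1 - k = n + 1 := by omega
    rw [e1] at hstep hch
    have hch' : ((n + k).choose k : ℝ) * ((n + k + 1 : ℕ) : ℝ) =
        ((n + k + 1).choose k : ℝ) * ((n + 1 : ℕ) : ℝ) := by exact_mod_cast hch
    have e2 : n + 1 + k = n + k + 1 := by omega
    have hp1 := hpos (n + 1)
    simp only [ha]
    rw [e2] at hp1 ⊢
    rw [div_le_div_iff₀ hp1 (hpos n)]
    have hn : (0 : ℝ) < ((n + 1 : ℕ) : ℝ) := by positivity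
    refine le_of_mul_le_mul_left ?_ hn
    have h3 := mul_le_mul_of_nonneg_right hstep (hpos n).le
    calc _ = ((n + 1 : ℕ) : ℝ) * g (n + k + 1) * ((n + k).choose k : ℝ) := by ring
      _ ≤ _ := h3
      _ = g (n + k) * (((n + k).choose k : ℝ) * ((n + k + 1 : ℕ) : ℝ)) := by ring
      _ = _ := by rw [hch']; ring
  have hlim : Tendsto a atTop (𝓝 (⨅ n, a n)) :=
    tendsto_atTop_ciInf hanti ⟨0, by rintro _ ⟨n, rfl⟩; exact ha0 n⟩
  have hlim' : Tendsto (fun n => g n / (n.choose k : ℝ)) atTop (𝓝 (⨅ n, a n)) :=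
    (tendsto_add_atTop_iff_nat k).1 hlim
  have hch : Tendsto (fun n : ℕ => (n.choose k : ℝ) / (n : ℝ) ^ k) atTop
      (𝓝 (1 / (k.factorial : ℝ))) := by
    have h := ((isEquivalent_choose k).div (IsEquivalent.refl (u := fun n : ℕ => (n : ℝ) ^ k))).symm
    refine h.tendsto_nhds (tendsto_const_nhds.congr' ?_)
    filter_upwards [eventually_gt_atTop 0] with n hn
    have : (n : ℝ) ≠ 0 := by exact_mod_cast hn.ne'
    simp only [Pi.div_apply]
    field_simp
  refine ⟨(⨅ n, a n) * (1 / (k.factorial : ℝ)),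
    mul_nonneg (Real.iInf_nonneg ha0) (by positivity), (hlim'.mul hch).congr' ?_⟩
  filter_upwards [eventually_ge_atTop k] with n hn
  have : (n.choose k : ℝ) ≠ 0 := by exact_mod_cast (Nat.choose_pos hn).ne'
  field_simp

end Limit
end PaperEntropy

namespace PaperEntropy
section Restriction
open scoped Classical
open FirstOrder.Language

variable {L : FirstOrder.Language} {k : ℕ}

lemma measurableSet_relMap {m : ℕ} (r : L.Relations m) (v : Fin m → ℕ) :
    MeasurableSet {S : L.Structure ℕ | @Structure.RelMap L ℕ S m r v} := by
  refine MeasurableSpace.measurableSet_generateFrom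
    ⟨m, r.formula fun i => Term.var i, (BoundedFormula.IsAtomic.rel _ _).isQF, v, ?_⟩
  ext S
  let := S
  simp [Formula.realize_rel]

/-- The atomic relations of arity `k` holding in the restriction of a structure to `[n]`. -/
def relSet (L : FirstOrder.Language) (k n : ℕ) (S : L.Structure ℕ) :
    Set (L.Relations k × (Fin k → Fin n)) :=
  {a | @Structure.RelMap L ℕ S k a.1 fun j => (a.2 j : ℕ)}

lemma measurableSet_relSet_preimage [Finite (L.Relations k)] (n : ℕ)
    (B : Set (Set (L.Relations k × (Fin k → Fin n)))) :
    MeasurableSet (relSet L k n ⁻¹' B) := by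
  have hsingle : ∀ x, MeasurableSet (relSet L k n ⁻¹' {x}) := by
    intro x
    have : relSet L k n ⁻¹' {x} = ⋂ a, {S | a ∈ relSet L k n S ↔ a ∈ x} := by
      ext S
      simp [Set.ext_iff]
    rw [this]
    refine MeasurableSet.iInter fun a => ?_
    have ha : MeasurableSet {S | a ∈ relSet L k n S} := measurableSet_relMap _ _
    by_cases hx : a ∈ x
    · simpa [hx] using ha
    · simp only [hx, iff_false]
      exact ha.compl
  rw [← Set.biUnion_preimage_singleton]
  exact MeasurableSet.biUnion (Set.toFinite B).countable fun x _ => hsingle x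

/-- The distribution of the atomic relations on `[n]`. -/
noncomputable def relDist (μ : Measure (L.Structure ℕ)) (k n : ℕ)
    (x : Set (L.Relations k × (Fin k → Fin n))) : ℝ :=
  μ.real (relSet L k n ⁻¹' {x})

lemma sum_relDist [Fintype (L.Relations k)] (μ : Measure (L.Structure ℕ)) [IsProbabilityMeasure μ]
    (n : ℕ) (B : Set (Set (L.Relations k × (Fin k → Fin n)))) :
    ∑ x, (if x ∈ B then relDist μ k n x else 0) = μ.real (relSet L k n ⁻¹' B) := by
  rw [← Finset.sum_filter]
  have := sum_measureReal_preimage_singleton (μ := μ) (Finset.univ.filter (· ∈ B))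
    (f := relSet L k n) fun y _ => measurableSet_relSet_preimage n {y}
  simpa [relDist] using this

lemma exists_perm_succAbove {n : ℕ} (i : Fin (n + 1)) :
    ∃ σ : Equiv.Perm ℕ, ∀ j : Fin n, σ (j : ℕ) = (i.succAbove j : ℕ) := by
  set e := (finSuccAboveEquiv (Fin.last n)).symm.trans (finSuccAboveEquiv i) with he
  refine ⟨e.extendSubtype.extendDomain (Fin.equivSubtype (n := n + 1)), fun j => ?_⟩
  have h1 := Equiv.Perm.extendDomain_apply_image e.extendSubtype
    (Fin.equivSubtype (n := n + 1)) j.castSucc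
  have hj : j.castSucc ≠ Fin.last n := (Fin.castSucc_lt_last j).ne
  have h2 : e.extendSubtype j.castSucc = i.succAbove j := by
    rw [Equiv.extendSubtype_apply_of_mem e _ hj]
    have h3 : (⟨j.castSucc, hj⟩ : {x : Fin (n + 1) // x ≠ Fin.last n}) =
        finSuccAboveEquiv (Fin.last n) j := by
      ext
      simp [finSuccAboveEquiv_apply]
    rw [h3, he, Equiv.trans_apply, Equiv.symm_apply_apply, finSuccAboveEquiv_apply]
  rw [h2] at h1
  exact h1

/-- The atomic relations that hold after deleting the point `i` of `[n + 1]`. -/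
def deletePoint {n : ℕ} (i : Fin (n + 1)) (x : Set (L.Relations k × (Fin k → Fin (n + 1)))) :
    Set (L.Relations k × (Fin k → Fin n)) :=
  {a | (a.1, fun j => i.succAbove (a.2 j)) ∈ x}

lemma agreeOn_avoid_eq_ker {n : ℕ} (i : Fin (n + 1)) :
    agreeOn {a : L.Relations k × (Fin k → Fin (n + 1)) | ∀ j, a.2 j ≠ i} =
      Setoid.ker (deletePoint i) := by
  ext x y
  rw [Setoid.ker_def, agreeOn_apply]
  constructor
  · intro h
    ext a
    exact h (a.1, fun j => i.succAbove (a.2 j)) fun j => Fin.succAbove_ne i _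
  · rintro h ⟨r, v⟩ hv
    choose w hw using fun j => Fin.exists_succAbove_eq (hv j)
    have := Set.ext_iff.1 h (r, w)
    simpa [deletePoint, hw] using this

lemma relDist_eq_sum_deletePoint [Fintype (L.Relations k)] {μ : Measure (L.Structure ℕ)}
    (hμ : IsInvariantMeasure L μ) {n : ℕ} (i : Fin (n + 1))
    (y : Set (L.Relations k × (Fin k → Fin n))) :
    relDist μ k n y = ∑ x, if deletePoint i x = y then relDist μ k (n + 1) x else 0 := by
  have := hμ.1
  obtain ⟨σ, hσ⟩ := exists_perm_succAbove i
  have hinv := hμ.2 σ.symm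
  have hae : AEMeasurable (logicAction L σ.symm) μ := by
    by_contra h
    rw [Measure.map_of_not_aemeasurable h] at hinv
    exact IsProbabilityMeasure.ne_zero μ hinv.symm
  have h1 : relDist μ k n y = μ.real (relSet L k (n + 1) ⁻¹' {x | deletePoint i x = y}) := by
    rw [relDist]
    conv_lhs => rw [← hinv]
    rw [measureReal_def, Measure.map_apply_of_aemeasurable hae (measurableSet_relSet_preimage n _),
      measureReal_def]
    congr 2
    ext S
    simp only [Set.mem_preimage, Set.mem_singleton_iff, Set.mem_ofPred_eq]
    have : relSet L k n (logicAction L σ.symm S) = deletePoint i (relSet L k (n + 1) S) := by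
      ext a
      change @Structure.RelMap L ℕ S k a.1 (fun j => σ (a.2 j : ℕ)) ↔
        @Structure.RelMap L ℕ S k a.1 fun j => (i.succAbove (a.2 j) : ℕ)
      simp only [hσ]
    rw [this]
  rw [h1, ← sum_relDist]
  rfl

/-- The entropy, in nats, of the atomic relations on `[n]`. -/
noncomputable def relEntropy [Fintype (L.Relations k)] (μ : Measure (L.Structure ℕ)) (n : ℕ) : ℝ :=
  ∑ x, Real.negMulLog (relDist μ k n x)

lemma relEntropy_succ_le [Fintype (L.Relations k)] {μ : Measure (L.Structure ℕ)}
    (hμ : IsInvariantMeasure L μ) (n : ℕ) :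
    ((n + 1 - k : ℕ) : ℝ) * relEntropy (k := k) μ (n + 1) ≤
      (n + 1 : ℕ) * relEntropy (k := k) μ n := by
  have := hμ.1
  have hp : ∀ x, 0 ≤ relDist μ k (n + 1) x := fun x => measureReal_nonneg
  have h1 : ∑ x, relDist μ k (n + 1) x = 1 := by
    simpa using sum_relDist (k := k) μ (n + 1) Set.univ
  have hcover : ∀ a : L.Relations k × (Fin k → Fin (n + 1)), n + 1 - k ≤
      (Finset.univ.filter fun i : Fin (n + 1) => a ∈ {a : L.Relations k × (Fin k → Fin (n + 1)) |
        ∀ j, a.2 j ≠ i}).card := by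
    intro a
    have heq : (Finset.univ.filter fun i : Fin (n + 1) => a ∈
        {a : L.Relations k × (Fin k → Fin (n + 1)) | ∀ j, a.2 j ≠ i}) =
        (Finset.univ.image a.2)ᶜ := by
      ext i
      simp
    rw [heq, Finset.card_compl, Fintype.card_fin]
    have : (Finset.univ.image a.2).card ≤ k := Finset.card_image_le.trans (by simp)
    omega
  have hsh := shearer hp h1 (fun i : Fin (n + 1) =>
    {a : L.Relations k × (Fin k → Fin (n + 1)) | ∀ j, a.2 j ≠ i}) (n + 1 - k) (by convert hcover)
  have huniv : agreeOn (Set.univ : Set (L.Relations k × (Fin k → Fin (n + 1)))) =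
      Setoid.ker id := by
    ext x y
    simp [agreeOn_apply, Setoid.ker_def, Set.ext_iff]
  have hdel : ∀ i : Fin (n + 1), partitionEntropy (relDist μ k (n + 1))
      (agreeOn {a : L.Relations k × (Fin k → Fin (n + 1)) | ∀ j, a.2 j ≠ i}) =
      relEntropy (k := k) μ n := fun i => by
    rw [agreeOn_avoid_eq_ker, partitionEntropy_ker (relDist_eq_sum_deletePoint hμ i), relEntropy]
  rw [huniv, partitionEntropy_ker (q := relDist μ k (n + 1)) (fun y => by
      rw [Finset.sum_eq_single y] <;> simp +contextual),
    Finset.sum_congr rfl fun i _ => hdel i] at hsh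
  simpa [relEntropy] using hsh

lemma measurable_restrict [L.IsRelational] (n : ℕ) : Measurable (restrict L n) := by
  refine measurable_generateFrom ?_
  rintro _ (⟨m, r, v, rfl⟩ | ⟨m, f, v, o, rfl⟩)
  · exact measurableSet_relMap r _
  · exact isEmptyElim f

/-- A restriction in a relational language with only `k`-ary symbols is a set of atoms. -/
noncomputable def finRestrictionEquiv [L.IsRelational]
    (harity : ∀ m, m ≠ k → IsEmpty (L.Relations m)) (n : ℕ) :
    FinRestriction L n ≃ Set (L.Relations k × (Fin k → Fin n)) :=
  Equiv.ofBijective (fun x => {a | x.rel k a.1 a.2}) <| by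
    constructor
    · rintro ⟨r, f⟩ ⟨r', f'⟩ h
      congr
      · funext m s v
        by_cases hm : m = k
        · subst hm
          exact propext (Set.ext_iff.1 h (s, v))
        · exact (harity m hm).elim s
      · funext m s
        exact isEmptyElim s
    · intro B
      refine ⟨⟨fun m s v => ∃ h : m = k, ((h ▸ s, fun j => v (Fin.cast h.symm j)) :
        L.Relations k × (Fin k → Fin n)) ∈ B, fun m f => isEmptyElim f⟩, ?_⟩
      ext ⟨s, v⟩
      simp

lemma finRestrictionEquiv_restrict [L.IsRelational]
    (harity : ∀ m, m ≠ k → IsEmpty (L.Relations m)) (n : ℕ) (S : L.Structure ℕ) :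
    finRestrictionEquiv harity n (restrict L n S) = relSet L k n S := rfl

lemma measurableSet_finRestriction_singleton [L.IsRelational] [Finite (L.Relations k)]
    (harity : ∀ m, m ≠ k → IsEmpty (L.Relations m)) (n : ℕ) (x : FinRestriction L n) :
    MeasurableSet {x} := by
  have : {x} = ⋂ a : L.Relations k × (Fin k → Fin n),
      {y : FinRestriction L n | y.rel k a.1 a.2 ↔ x.rel k a.1 a.2} := by
    ext y
    rw [Set.mem_singleton_iff, ← (finRestrictionEquiv harity n).injective.eq_iff, Set.ext_iff,
      Set.mem_iInter]
    rfl
  rw [this]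
  refine MeasurableSet.iInter fun a => ?_
  have ha : MeasurableSet {y : FinRestriction L n | y.rel k a.1 a.2} :=
    MeasurableSpace.measurableSet_generateFrom (Or.inl ⟨k, a.1, a.2, rfl⟩)
  by_cases hx : x.rel k a.1 a.2
  · simpa [hx] using ha
  · simp only [hx, iff_false]
    exact ha.compl

lemma entropy_of_fintype {α : Type*} [Fintype α] [MeasurableSpace α] [MeasurableSingletonClass α]
    (ν : Measure α) [IsProbabilityMeasure ν] :
    entropy ν = ENNReal.ofReal ((∑ a, Real.negMulLog (ν.real {a})) / Real.log 2) := by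
  have hterm : ∀ a, -((ν {a}).toReal * Real.logb 2 (ν {a}).toReal) =
      Real.negMulLog (ν.real {a}) / Real.log 2 := fun a => by
    rw [Real.negMulLog, Real.logb, measureReal_def]
    ring
  rw [entropy, if_pos, tsum_fintype, ← ENNReal.ofReal_sum_of_nonneg, Finset.sum_div]
  · simp only [hterm]
  · intro a _
    rw [hterm]
    exact div_nonneg (Real.negMulLog_nonneg measureReal_nonneg measureReal_le_one)
      (Real.log_nonneg one_le_two)
  · rw [tsum_fintype]
    simp

lemma entFn_eq_ofReal [L.IsRelational] [Fintype (L.Relations k)]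
    (harity : ∀ m, m ≠ k → IsEmpty (L.Relations m))
    (μ : Measure (L.Structure ℕ)) [IsProbabilityMeasure μ] (n : ℕ) :
    entFn L μ n = ENNReal.ofReal (relEntropy (k := k) μ n / Real.log 2) := by
  let : Fintype (FinRestriction L n) := Fintype.ofEquiv _ (finRestrictionEquiv harity n).symm
  have : MeasurableSingletonClass (FinRestriction L n) :=
    ⟨measurableSet_finRestriction_singleton harity n⟩
  have hm := measurable_restrict (L := L) n
  have := Measure.isProbabilityMeasure_map (μ := μ) hm.aemeasurable
  rw [entFn, entropy_of_fintype, relEntropy]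
  congr 2
  refine Fintype.sum_equiv (finRestrictionEquiv harity n) _ _ fun x => ?_
  rw [relDist, measureReal_def, Measure.map_apply hm (measurableSet_singleton x), measureReal_def]
  congr 3
  ext S
  simp only [Set.mem_preimage, Set.mem_singleton_iff, ← finRestrictionEquiv_restrict harity,
    (finRestrictionEquiv harity n).injective.eq_iff]

lemma relEntropy_nonneg [Fintype (L.Relations k)] (μ : Measure (L.Structure ℕ))
    [IsProbabilityMeasure μ] (n : ℕ) : 0 ≤ relEntropy (k := k) μ n :=
  Finset.sum_nonneg fun _ _ => Real.negMulLog_nonneg measureReal_nonneg measureReal_le_one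

end Restriction
end PaperEntropy

open PaperEntropy MeasureTheory
open scoped ENNReal

/-- For a finite relational language `L` all of whose relation symbols
have arity `k ≥ 1` and a non-redundant invariant measure `μ` on `Str_L(ℕ)`, there is a
constant `C ≥ 0` with `Ent(μ)(n) = C·n^k + o(n^k)`; in particular `Ent(μ)(n) = O(n^k)`. -/
theorem entFn_asymptotics_nonredundant
    (k : ℕ) (hk : 1 ≤ k)
    (L : FirstOrder.Language) (_ : L.IsRelational)
    (hfin : ∀ m, Finite (L.Relations m))
    (harity : ∀ m, m ≠ k → IsEmpty (L.Relations m))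
    (μ : Measure (L.Structure ℕ)) (hμ : IsInvariantMeasure L μ)
    (hnr : μ (NonRedundant L ℕ) = 1) :
    (∀ n : ℕ, entFn L μ n ≠ ⊤) ∧
    ∃ C : ℝ, 0 ≤ C ∧
      (fun n : ℕ => (entFn L μ n).toReal - C * (n : ℝ) ^ k)
        =o[Filter.atTop] (fun n : ℕ => (n : ℝ) ^ k) ∧
      (fun n : ℕ => (entFn L μ n).toReal) =O[Filter.atTop] (fun n : ℕ => (n : ℝ) ^ k) := by
  have := hμ.1
  have := hfin k
  let := Fintype.ofFinite (L.Relations k)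
  have hlog : 0 < Real.log 2 := Real.log_pos one_lt_two
  have hent : ∀ n, (entFn L μ n).toReal = relEntropy (k := k) μ n / Real.log 2 := fun n => by
    rw [entFn_eq_ofReal harity,
      ENNReal.toReal_ofReal (div_nonneg (relEntropy_nonneg μ n) hlog.le)]
  refine ⟨fun n => by rw [entFn_eq_ofReal harity]; exact ENNReal.ofReal_ne_top, ?_⟩
  obtain ⟨C, hC, hlim⟩ := exists_tendsto_div_pow (g := fun n => (entFn L μ n).toReal)
    (fun n => ENNReal.toReal_nonneg) k fun n _ => by
      rw [hent, hent, mul_div_assoc', mul_div_assoc']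
      exact div_le_div_of_nonneg_right (relEntropy_succ_le hμ n) hlog.le
  have hne : ∀ᶠ n : ℕ in Filter.atTop, (n : ℝ) ^ k ≠ 0 := by
    filter_upwards [Filter.eventually_gt_atTop 0] with n hn
    positivity
  have hlittle : (fun n : ℕ => (entFn L μ n).toReal - C * (n : ℝ) ^ k)
      =o[Filter.atTop] (fun n : ℕ => (n : ℝ) ^ k) := by
    rw [Asymptotics.isLittleO_iff_tendsto' (hne.mono fun n hn h => absurd h hn)]
    refine ((hlim.sub_const C).congr' ?_).trans (by rw [sub_self])
    filter_upwards [hne] with n hn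
    rw [sub_div, mul_div_cancel_right₀ _ hn]
  refine ⟨C, hC, hlittle, ?_⟩
  simpa using hlittle.isBigO.add ((Asymptotics.isBigO_refl _ _).const_mul_left C)
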